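/- Let p be a prime with p ≥ 5, n ≥ 1 an integer, and let a, b be integers not divisible by p such that a and b are not congruent modulo p. If the (a mod p, b mod p)-dynomial minimal solution over ℤ/pℤ is irreducible, then the (a mod pⁿ, b mod pⁿ)-dynomial minimal solution over ℤ/pⁿℤ is irreducible. -/

import Mathlib

namespace Quiddity

variable {A : Type*} [CommRing A]

/-- `mMat [a₁, …, aₙ]` is the matrix product `[[aₙ,-1],[1,0]] ⋯ [[a₁,-1],[1,0]]`. -/
def mMat : List A → Matrix (Fin 2) (Fin 2) A
  | [] => 1
  | a :: t => mMat t * !![a, -1; 1, 0]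

/-- Continuant: `cont [] = K₀ = 1`, `cont [a] = K₁(a) = a`, and the continuant recursion. -/
def cont : List A → A
  | [] => 1
  | [a] => a
  | a :: b :: t => a * cont (b :: t) - cont t

/-- A λ-quiddity is a tuple with `Mₙ(a₁,…,aₙ) = ± Id`. -/
def IsQuiddity (l : List A) : Prop := mMat l = 1 ∨ mMat l = -1

/-- The sum `⊕` of two tuples (meaningful for tuples of length ≥ 2):
`(a₁,…,aₘ) ⊕ (b₁,…,b_l) = (a₁+b_l, a₂,…,a_{m−1}, aₘ+b₁, b₂,…,b_{l−1})`. -/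
def oplus (la lb : List A) : List A :=
  (la.headD 0 + lb.getLastD 0) ::
    (la.tail.dropLast ++ (la.getLastD 0 + lb.headD 0) :: lb.tail.dropLast)

/-- Two tuples are equivalent if one is a cyclic permutation of the other or of its
reversal. -/
def TupleEquiv (l l' : List A) : Prop :=
  List.IsRotated l l' ∨ List.IsRotated l.reverse l'

/-- A λ-quiddity `c` is reducible if `c ∼ a ⊕ b` with `b` a λ-quiddity and both of size ≥ 3. -/
def QuiddityReducible (c : List A) : Prop :=
  ∃ a b : List A, 3 ≤ a.length ∧ 3 ≤ b.length ∧ IsQuiddity b ∧ TupleEquiv c (oplus a b)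

/-- `(a, b, a, b, …, a, b)` with `k` repetitions of the pair `(a, b)` (size `2k`). -/
def dynList : ℕ → A → A → List A
  | 0, _, _ => []
  | k + 1, a, b => a :: b :: dynList k a b

/-- `(u, v, v, u, v, v, …, u, v, v)` with `k` repetitions of the block `(u, v, v)`
(size `3k`). -/
def triList : ℕ → A → A → List A
  | 0, _, _ => []
  | k + 1, a, b => a :: b :: b :: triList k a b

end Quiddity

open Quiddity

namespace Quiddity

variable {A : Type*} [CommRing A]

lemma mMat_append (l l' : List A) : mMat (l ++ l') = mMat l' * mMat l := by
  induction l with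
  | nil => simp [mMat]
  | cons x t ih => simp [mMat, ih, mul_assoc]

lemma det_mMat (l : List A) : (mMat l).det = 1 := by
  induction l with
  | nil => simp [mMat]
  | cons x t ih => simp [mMat, ih, Matrix.det_fin_two]

lemma mapMatrix_mMat {B : Type*} [CommRing B] (f : A →+* B) (l : List A) :
    f.mapMatrix (mMat l) = mMat (l.map f) := by
  induction l with
  | nil => simp [mMat]
  | cons x t ih =>
    have h : f.mapMatrix !![x, -1; 1, 0] = !![f x, -1; 1, 0] := by
      ext i j; fin_cases i <;> fin_cases j <;> simp
    rw [mMat, map_mul, ih, h, List.map_cons, mMat]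

lemma isQuiddity_map {B : Type*} [CommRing B] (f : A →+* B) {l : List A}
    (h : IsQuiddity l) : IsQuiddity (l.map f) := by
  rcases h with h | h
  · left; rw [← mapMatrix_mMat, h, map_one]
  · right; rw [← mapMatrix_mMat, h, map_neg, map_one]

lemma map_dynList {α β : Type*} (f : α → β) (k : ℕ) (a b : α) :
    (dynList k a b).map f = dynList k (f a) (f b) := by
  induction k with
  | zero => rfl
  | succ k ih => simp [dynList, ih]

lemma length_dynList {α : Type*} (k : ℕ) (a b : α) : (dynList k a b).length = 2 * k := by
  induction k with
  | zero => rfl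
  | succ k ih => simp [dynList, ih]; ring

lemma dynList_add {α : Type*} (i j : ℕ) (a b : α) :
    dynList (i + j) a b = dynList i a b ++ dynList j a b := by
  induction i with
  | zero => simp [dynList]
  | succ i ih =>
    rw [show i + 1 + j = i + j + 1 by omega]
    simp [dynList, ih]

lemma dynList_append_singleton {α : Type*} (k : ℕ) (a b : α) :
    dynList k a b ++ [a] = a :: dynList k b a := by
  induction k with
  | zero => rfl
  | succ k ih => simp [dynList, ih]

lemma rotate_one_dynList {α : Type*} (k : ℕ) (a b : α) : (dynList k a b).rotate 1 = dynList k b a := by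
  cases k with
  | zero => rfl
  | succ k => simp [dynList, dynList_append_singleton]

lemma reverse_dynList {α : Type*} (k : ℕ) (a b : α) : (dynList k a b).reverse = dynList k b a := by
  induction k with
  | zero => rfl
  | succ k ih =>
    rw [dynList_add]
    simp [dynList, ih]

lemma rotate_dynList {α : Type*} (k i : ℕ) (a b : α) :
    (dynList k a b).rotate i = dynList k a b ∨ (dynList k a b).rotate i = dynList k b a := by
  induction i with
  | zero => simp
  | succ i ih =>
    rw [← List.rotate_rotate]
    rcases ih with h | h <;> rw [h, rotate_one_dynList] <;> simp

/-- A tuple equivalent to a dynomial one is dynomial. -/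
lemma eq_dynList_of_tupleEquiv {α : Type*} {k : ℕ} {a b : α} {l : List α}
    (h : TupleEquiv (dynList k a b) l) : l = dynList k a b ∨ l = dynList k b a := by
  rcases h with ⟨i, rfl⟩ | ⟨i, rfl⟩
  · exact rotate_dynList k i a b
  · rw [reverse_dynList]
    exact (rotate_dynList k i b a).symm

lemma mMat_dynList (k : ℕ) (a b : A) : mMat (dynList k a b) = mMat [a, b] ^ k := by
  induction k with
  | zero => simp [dynList, mMat]
  | succ k ih =>
    rw [pow_succ, ← ih, ← mMat_append]
    rfl

lemma isQuiddity_dynList_swap {k : ℕ} {a b : A} (h : IsQuiddity (dynList k a b)) :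
    IsQuiddity (dynList k b a) := by
  have hu : IsUnit (mMat [a]) := by
    rw [Matrix.isUnit_iff_isUnit_det, det_mMat]; exact isUnit_one
  have key : mMat [a] * mMat (dynList k a b) = mMat (dynList k b a) * mMat [a] := by
    rw [← mMat_append, dynList_append_singleton, ← mMat_append, List.singleton_append]
  rcases h with h | h <;> rw [h] at key
  · left; exact hu.mul_right_cancel (by simpa using key.symm)
  · right; exact hu.mul_right_cancel (by simpa using key.symm)

lemma bordered_mul_eq (x y : A) (M : Matrix (Fin 2) (Fin 2) A) :
    !![y, -1; 1, 0] * M * !![x, -1; 1, 0] =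
      !![(y * M 0 0 - M 1 0) * x + (y * M 0 1 - M 1 1), -(y * M 0 0 - M 1 0);
        M 0 0 * x + M 0 1, -M 0 0] := by
  ext i j
  fin_cases i <;> fin_cases j <;>
    simp [Matrix.mul_apply, Fin.sum_univ_two, Matrix.vecMul, dotProduct] <;> ring

lemma mMat_bordered (x y : A) (w : List A) :
    mMat (x :: (w ++ [y])) = !![y, -1; 1, 0] * mMat w * !![x, -1; 1, 0] := by
  simp [mMat, mMat_append]

/-- The continuant of the interior of a λ-quiddity is `±1`. -/
lemma mMat_interior_of_isQuiddity {x y : A} {w : List A}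
    (h : IsQuiddity (x :: (w ++ [y]))) : mMat w 0 0 = 1 ∨ mMat w 0 0 = -1 := by
  rw [IsQuiddity, mMat_bordered, bordered_mul_eq] at h
  rcases h with h | h
  · right
    have := congrFun (congrFun h 1) 1
    simp at this
    rw [← this, neg_neg]
  · left
    have := congrFun (congrFun h 1) 1
    simpa using this

/-- A tuple whose continuant is `±1` is the interior of a λ-quiddity. -/
lemma exists_isQuiddity_of_mMat {w : List A} (h : mMat w 0 0 = 1 ∨ mMat w 0 0 = -1) :
    ∃ x y : A, IsQuiddity (x :: (w ++ [y])) := by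
  have hd := det_mMat w
  rw [Matrix.det_fin_two] at hd
  rcases h with h | h
  · refine ⟨-mMat w 0 1, mMat w 1 0, Or.inr ?_⟩
    rw [mMat_bordered, bordered_mul_eq, h]
    rw [h] at hd
    ext i j
    fin_cases i <;> fin_cases j <;> simp
    linear_combination -hd
  · refine ⟨mMat w 0 1, -mMat w 1 0, Or.inl ?_⟩
    rw [mMat_bordered, bordered_mul_eq, h]
    rw [h] at hd
    ext i j
    fin_cases i <;> fin_cases j <;> simp
    linear_combination hd

/-- Powers of `T = mMat [a, b]` are combinations of `T` and `1`. -/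
lemma exists_pow_eq (a b : A) (s : ℕ) :
    ∃ U V : A, mMat [a, b] ^ s = !![(a * b - 1) * U - V, -b * U; a * U, -U - V] := by
  induction s with
  | zero =>
    refine ⟨0, -1, ?_⟩
    ext i j; fin_cases i <;> fin_cases j <;> simp
  | succ s ih =>
    obtain ⟨U, V, h⟩ := ih
    refine ⟨(a * b - 2) * U - V, U, ?_⟩
    rw [pow_succ, h]
    ext i j
    fin_cases i <;> fin_cases j <;>
      simp [mMat, Matrix.mul_apply, Fin.sum_univ_two] <;> ring

/-- If `a b` is a unit, a dynomial tuple of continuant `±1` is a λ-quiddity or becomes one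
after appending `(a, b)`, as soon as the ring has no `x (x ∓ 1) = 0` with `x ≠ 0, ±1`. -/
lemma isQuiddity_or_of_mMat_dynList {a b δ : A} (hab : IsUnit (a * b)) (hδ : δ = 1 ∨ δ = -1)
    (hid : ∀ x : A, x * (x - δ) = 0 → x = 0 ∨ x = δ) {s : ℕ}
    (h : mMat (dynList s a b) 0 0 = δ) :
    IsQuiddity (dynList s a b) ∨ IsQuiddity (dynList (s + 1) a b) := by
  have hδ2 : δ * δ = 1 := by rcases hδ with rfl | rfl <;> simp
  obtain ⟨U, V, hU⟩ := exists_pow_eq a b s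
  have hd := det_mMat (dynList s a b)
  rw [mMat_dynList, hU] at h hd
  simp [Matrix.det_fin_two] at h hd
  have hV : V = (a * b - 1) * U - δ := by linear_combination -h
  have hz : U * (U - δ) = 0 := by
    apply hab.mul_left_cancel
    subst hV
    linear_combination hd - hδ2
  have hscal : δ • (1 : Matrix (Fin 2) (Fin 2) A) = 1 ∨
      δ • (1 : Matrix (Fin 2) (Fin 2) A) = -1 := by
    rcases hδ with rfl | rfl <;> simp
  rcases hid U hz with rfl | rfl
  · left
    have : mMat (dynList s a b) = δ • (1 : Matrix (Fin 2) (Fin 2) A) := by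
      rw [mMat_dynList, hU, hV]
      ext i j; fin_cases i <;> fin_cases j <;> simp
    rwa [IsQuiddity, this]
  · right
    have : mMat (dynList (s + 1) a b) = -(U • (1 : Matrix (Fin 2) (Fin 2) A)) := by
      rw [mMat_dynList, pow_succ, hU, hV]
      ext i j
      fin_cases i <;> fin_cases j <;>
        simp [mMat, Matrix.mul_apply, Fin.sum_univ_two] <;> ring
    rw [IsQuiddity, this, neg_inj, neg_eq_iff_eq_neg]
    exact hscal.symm

lemma drop_dynList_even {α : Type*} {k i : ℕ} (hi : i ≤ k) (a b : α) :
    (dynList k a b).drop (2 * i) = dynList (k - i) a b := by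
  obtain ⟨j, rfl⟩ := Nat.exists_eq_add_of_le hi
  rw [dynList_add, List.drop_left' (length_dynList i a b), Nat.add_sub_cancel_left]

lemma drop_dynList_odd {α : Type*} {k i : ℕ} (hi : i < k) (a b : α) :
    (dynList k a b).drop (2 * i + 1) = b :: dynList (k - i - 1) a b := by
  rw [← List.drop_drop, drop_dynList_even hi.le]
  obtain ⟨j, rfl⟩ := Nat.exists_eq_add_of_lt hi
  rw [show i + j + 1 - i = j + 1 by omega]
  rfl

/-- If a dynomial tuple is a sum, the interior of the second summand is one of its suffixes. -/
lemma exists_drop_of_oplus_eq {c la lb : List A} (hla : 3 ≤ la.length) (hlb : 3 ≤ lb.length)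
    (h : oplus la lb = c) :
    ∃ x y : A, ∃ m, 3 ≤ m ∧ m < c.length ∧ lb = x :: (c.drop m ++ [y]) := by
  obtain ⟨x, t, rfl⟩ : ∃ x t, lb = x :: t := by
    cases lb with
    | nil => simp at hlb
    | cons x t => exact ⟨x, t, rfl⟩
  rcases List.eq_nil_or_concat t with rfl | ⟨w, y, rfl⟩
  · simp at hlb
  refine ⟨x, y, la.length, hla, ?_, ?_⟩
  · subst h; simp [oplus] at hlb ⊢; omega
  · have hlen : (la.tail.dropLast).length + 2 = la.length := by simp; omega
    subst h
    rw [oplus, ← hlen, List.drop_succ_cons, List.drop_append]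
    simp

lemma oplus_bordered (x y x' y' : A) (w w' : List A) :
    oplus (x :: (w ++ [y])) (x' :: (w' ++ [y'])) = (x + y') :: (w ++ (y + x') :: w') := by
  have h (c z : A) (t : List A) : (c :: (t ++ [z])).getLastD 0 = z := by
    rw [← List.cons_append, List.getLastD_concat]
  rw [oplus, h, h]
  simp

/-- A dynomial tuple is reducible when it has a proper odd suffix of continuant `±1`. -/
lemma reducible_of_odd {s k : ℕ} (hs : s + 2 ≤ k) {a b : A}
    (h : mMat (b :: dynList s a b) 0 0 = 1 ∨ mMat (b :: dynList s a b) 0 0 = -1) :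
    QuiddityReducible (dynList k a b) := by
  obtain ⟨x, y, hq⟩ := exists_isQuiddity_of_mMat h
  obtain ⟨j, rfl⟩ := Nat.exists_eq_add_of_le hs
  refine ⟨(a - y) :: (b :: dynList j a b) ++ [a - x], x :: ((b :: dynList s a b) ++ [y]),
    ?_, ?_, hq, Or.inl ⟨0, ?_⟩⟩
  · simp
  · simp
  · rw [show s + 2 + j = (j + 1) + (s + 1) by omega, dynList_add]
    rw [List.cons_append, oplus_bordered, List.rotate_zero, sub_add_cancel, sub_add_cancel]
    rfl

lemma reducible_dynList_swap {k : ℕ} {a b : A} (h : QuiddityReducible (dynList k a b)) :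
    QuiddityReducible (dynList k b a) := by
  obtain ⟨l, l', h1, h2, h3, h4⟩ := h
  refine ⟨l, l', h1, h2, h3, ?_⟩
  rcases eq_dynList_of_tupleEquiv h4 with h | h <;> rw [h]
  · exact Or.inl ⟨1, rotate_one_dynList k b a⟩
  · exact Or.inl ⟨0, List.rotate_zero _⟩

/-- Odd alternating tuples of continuant `±1` reduce every dynomial λ-quiddity. -/
lemma reducible_of_isQuiddity_of_odd [Nontrivial A] {s k : ℕ} (hk : 0 < k) {a b : A}
    (hq : IsQuiddity (dynList k a b))
    (h : mMat (b :: dynList s a b) 0 0 = 1 ∨ mMat (b :: dynList s a b) 0 0 = -1) :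
    QuiddityReducible (dynList k a b) := by
  have hpow : (mMat [a, b] ^ k) ^ (s / k) = 1 ∨ (mMat [a, b] ^ k) ^ (s / k) = -1 := by
    rw [IsQuiddity, mMat_dynList] at hq
    rcases hq with hq | hq <;> rw [hq]
    · simp
    · exact neg_one_pow_eq_or _ _
  have hs : mMat (b :: dynList s a b) = mMat (b :: dynList (s % k) a b) ∨
      mMat (b :: dynList s a b) = -mMat (b :: dynList (s % k) a b) := by
    have : mMat [a, b] ^ s = (mMat [a, b] ^ k) ^ (s / k) * mMat [a, b] ^ (s % k) := by
      rw [← pow_mul, ← pow_add, Nat.div_add_mod]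
    simp only [mMat] at *
    simp only [mMat_dynList, mMat] at *
    rw [this]
    rcases hpow with hp | hp <;> rw [hp] <;> simp
  have h' : mMat (b :: dynList (s % k) a b) 0 0 = 1 ∨
      mMat (b :: dynList (s % k) a b) 0 0 = -1 := by
    rcases hs with e | e <;> rw [e] at h
    · exact h
    · simpa [neg_eq_iff_eq_neg, or_comm] using h
  refine reducible_of_odd (s := s % k) ?_ h'
  by_contra hlt
  have hmod := Nat.mod_lt s hk
  have hk1 : s % k + 1 = k := by omega
  rw [← hk1, IsQuiddity] at hq
  have hd : mMat (dynList (s % k + 1) a b) =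
      mMat (b :: dynList (s % k) a b) * !![a, -1; 1, 0] := rfl
  rw [hd] at hq
  have e : mMat (b :: dynList (s % k) a b) 0 0 = 0 := by
    rcases hq with hq | hq
    all_goals
      have := congrFun (congrFun hq 0) 1
      simpa [Matrix.mul_apply, Fin.sum_univ_two] using this
  rw [e] at h'
  simp at h'

end Quiddity

lemma ZMod.isUnit_intCast_prime_pow {p : ℕ} (hp : p.Prime) (n : ℕ) {a : ℤ}
    (h : ¬ (p : ℤ) ∣ a) : IsUnit (a : ZMod (p ^ n)) := by
  rw [ZMod.coe_int_isUnit_iff_isCoprime]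
  push_cast
  exact ((Nat.prime_iff_prime_int.mp hp).coprime_iff_not_dvd.mpr h).pow_left

lemma ZMod.eq_zero_or_eq_of_mul_sub_eq_zero {p : ℕ} (hp : p.Prime) (n : ℕ)
    {δ : ZMod (p ^ n)} (hδ : δ = 1 ∨ δ = -1) (x : ZMod (p ^ n)) (h : x * (x - δ) = 0) :
    x = 0 ∨ x = δ := by
  obtain ⟨z, rfl⟩ := ZMod.intCast_surjective x
  obtain ⟨d, rfl, hd⟩ : ∃ d : ℤ, (d : ZMod (p ^ n)) = δ ∧ IsUnit d := by
    rcases hδ with rfl | rfl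
    · exact ⟨1, by simp, isUnit_one⟩
    · exact ⟨-1, by simp, isUnit_one.neg⟩
  by_cases hz : (p : ℤ) ∣ z
  · left
    have hu : IsUnit ((z - d : ℤ) : ZMod (p ^ n)) := by
      refine ZMod.isUnit_intCast_prime_pow hp n fun hzd => ?_
      exact (Nat.prime_iff_prime_int.mp hp).not_isUnit
        (isUnit_of_dvd_unit ((dvd_sub_right hz).mp hzd) hd)
    push_cast at hu
    exact hu.mul_left_eq_zero.mp h
  · right
    exact sub_eq_zero.mp ((ZMod.isUnit_intCast_prime_pow hp n hz).mul_right_eq_zero.mp h)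

/-- for `p ≥ 5` prime, irreducibility of the `(a,b)`-dynomial minimal
solution mod `p` implies irreducibility of the one mod `pⁿ`. -/
theorem stmt11 (p : ℕ) (hp : p.Prime) (hp5 : 5 ≤ p) (n : ℕ) (hn : 1 ≤ n)
    (a b : ℤ) (hpa : ¬ (p : ℤ) ∣ a) (hpb : ¬ (p : ℤ) ∣ b)
    (hab : (a : ZMod p) ≠ (b : ZMod p))
    (hirr : ∀ k : ℕ, 0 < k →
      IsQuiddity (dynList k (a : ZMod p) (b : ZMod p)) →
      (∀ j, 0 < j → IsQuiddity (dynList j (a : ZMod p) (b : ZMod p)) → k ≤ j) →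
      ¬ QuiddityReducible (dynList k (a : ZMod p) (b : ZMod p))) :
    ∀ k : ℕ, 0 < k →
      IsQuiddity (dynList k (a : ZMod (p ^ n)) (b : ZMod (p ^ n))) →
      (∀ j, 0 < j →
        IsQuiddity (dynList j (a : ZMod (p ^ n)) (b : ZMod (p ^ n))) → k ≤ j) →
      ¬ QuiddityReducible (dynList k (a : ZMod (p ^ n)) (b : ZMod (p ^ n))) := by
  intro k hk hq hmin hred
  have hdvd : p ∣ p ^ n := dvd_pow_self p (by omega)
  have : Fact p.Prime := ⟨hp⟩
  let φ : ZMod (p ^ n) →+* ZMod p := ZMod.castHom hdvd (ZMod p)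
  have hqp : ∀ j, IsQuiddity (dynList j (a : ZMod (p ^ n)) (b : ZMod (p ^ n))) →
      IsQuiddity (dynList j (a : ZMod p) (b : ZMod p)) := fun j hj => by
    simpa [map_dynList] using isQuiddity_map φ hj
  obtain ⟨q, ⟨hq0, hqq⟩, hqmin⟩ : ∃ q, (0 < q ∧ IsQuiddity (dynList q (a : ZMod p) (b : ZMod p))) ∧
      ∀ j, 0 < j → IsQuiddity (dynList j (a : ZMod p) (b : ZMod p)) → q ≤ j := by
    classical
    have hex : ∃ q, 0 < q ∧ IsQuiddity (dynList q (a : ZMod p) (b : ZMod p)) :=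
      ⟨k, hk, hqp k hq⟩
    exact ⟨Nat.find hex, Nat.find_spec hex, fun j h1 h2 => Nat.find_min' hex ⟨h1, h2⟩⟩
  have hirrp := hirr q hq0 hqq hqmin
  have key : ∀ u v : ℤ, ¬ (p : ℤ) ∣ u → ¬ (p : ℤ) ∣ v →
      (∀ j, 0 < j → IsQuiddity (dynList j (u : ZMod (p ^ n)) (v : ZMod (p ^ n))) → k ≤ j) →
      IsQuiddity (dynList q (u : ZMod p) (v : ZMod p)) →
      ¬ QuiddityReducible (dynList q (u : ZMod p) (v : ZMod p)) →
      ∀ la lb : List (ZMod (p ^ n)), 3 ≤ la.length → 3 ≤ lb.length → IsQuiddity lb →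
      oplus la lb ≠ dynList k (u : ZMod (p ^ n)) (v : ZMod (p ^ n)) := by
    intro u v hu hv hmin hqq hirr la lb hla hlb hlbq heq
    obtain ⟨x, y, m, hm, hmk, rfl⟩ := exists_drop_of_oplus_eq hla hlb heq
    rw [length_dynList] at hmk
    have hw := mMat_interior_of_isQuiddity hlbq
    obtain ⟨i, rfl | rfl⟩ := Nat.even_or_odd' m
    · rw [drop_dynList_even (by omega)] at hw
      have huv : IsUnit ((u : ZMod (p ^ n)) * v) :=
        (ZMod.isUnit_intCast_prime_pow hp n hu).mul (ZMod.isUnit_intCast_prime_pow hp n hv)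
      rcases isQuiddity_or_of_mMat_dynList huv hw
        (ZMod.eq_zero_or_eq_of_mul_sub_eq_zero hp n hw) rfl with h | h
      · have := hmin _ (by omega) h
        omega
      · have := hmin _ (by omega) h
        omega
    · rw [drop_dynList_odd (by omega)] at hw
      refine hirr (reducible_of_isQuiddity_of_odd hq0 hqq (s := k - i - 1) ?_)
      have hmap := mapMatrix_mMat φ ((v : ZMod (p ^ n)) :: dynList (k - i - 1) (u : ZMod (p ^ n)) v)
      rw [List.map_cons, map_dynList, map_intCast, map_intCast] at hmap
      rw [← hmap, RingHom.mapMatrix_apply, Matrix.map_apply]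
      rcases hw with h | h <;> rw [h] <;> simp
  obtain ⟨la, lb, hla, hlb, hlbq, hequiv⟩ := hred
  rcases eq_dynList_of_tupleEquiv hequiv with h | h
  · exact key a b hpa hpb hmin hqq hirrp la lb hla hlb hlbq h
  · exact key b a hpb hpa (fun j hj hjq => hmin j hj (isQuiddity_dynList_swap hjq))
      (isQuiddity_dynList_swap hqq) (fun hr => hirrp (reducible_dynList_swap hr))
      la lb hla hlb hlbq h
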